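/- Let $C_{12}\subseteq\mathbb{R}^6$ be the cone generated by the twelve vectors $z_1=(0,1,0,0,0,0)$, $z_2=(0,0,1,0,0,0)$, $z_3=(0,0,0,1,0,0)$, $z_4=(0,0,0,0,1,0)$, $z_5=(0,0,0,0,0,1)$, $z_6=(1,0,2,1,1,2)$, $z_7=(1,2,0,2,1,1)$, $z_8=(1,1,2,0,2,1)$, $z_9=(1,1,1,2,0,2)$, $z_{10}=(1,2,1,1,2,0)$, $z_{11}'=(2,2,1,4,1,3)$, $z_{12}'=(2,3,1,4,1,2)$. Then $C_{12}$ fails both (UHC) and (ICP): there exists a point of $C_{12}$ contained in no cone generated by six of these twelve vectors forming a $\mathbb{Z}$-basis of $\mathbb{Z}^6$, and there exists a lattice point $x\in C_{12}\cap\mathbb{Z}^6$ such that every representation $x=\sum_{i} a_i z_i$ with nonnegative integer coefficients has at least seven nonzero coefficients. -/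

import Mathlib

/-- The real vector corresponding to an integer vector. -/
def toR {d : ℕ} (x : Fin d → ℤ) : Fin d → ℝ := fun i => (x i : ℝ)

/-- The cone generated by a finite family of integer vectors. -/
def coneFin {d n : ℕ} (v : Fin n → (Fin d → ℤ)) : Set (Fin d → ℝ) :=
  { y | ∃ a : Fin n → ℝ, (∀ i, 0 ≤ a i) ∧ y = ∑ i, a i • toR (v i) }

/-- The cone generated by a set of integer vectors (nonnegative real combinations
of finitely many of its elements). -/
def coneSet {d : ℕ} (B : Set (Fin d → ℤ)) : Set (Fin d → ℝ) :=
  { y | ∃ (n : ℕ) (v : Fin n → (Fin d → ℤ)) (a : Fin n → ℝ),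
      (∀ i, v i ∈ B) ∧ (∀ i, 0 ≤ a i) ∧ y = ∑ i, a i • toR (v i) }

/-- A finitely generated rational cone. -/
def IsRatCone {d : ℕ} (C : Set (Fin d → ℝ)) : Prop :=
  ∃ B : Finset (Fin d → ℤ), C = coneSet (B : Set (Fin d → ℤ))

/-- A pointed cone: `x, -x ∈ C` implies `x = 0`. -/
def PointedSet {d : ℕ} (C : Set (Fin d → ℝ)) : Prop :=
  ∀ x ∈ C, -x ∈ C → x = 0

/-- A full-dimensional subset of `ℝ^d`. -/
def FullDim {d : ℕ} (C : Set (Fin d → ℝ)) : Prop :=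
  Submodule.span ℝ C = ⊤

/-- The Hilbert basis of the monoid `C ∩ ℤ^d`: the nonzero lattice points of `C`
admitting no decomposition into two nonzero lattice points of `C`. -/
def hilbC {d : ℕ} (C : Set (Fin d → ℝ)) : Set (Fin d → ℤ) :=
  { z | toR z ∈ C ∧ z ≠ 0 ∧
    ¬∃ u v : Fin d → ℤ, toR u ∈ C ∧ toR v ∈ C ∧ u ≠ 0 ∧ v ≠ 0 ∧ z = u + v }

/-- The twelve generators of the cone `C₁₂`: the Hilbert basis of `C₁₀`
together with `z₁₁' = (2,2,1,4,1,3)` and `z₁₂' = (2,3,1,4,1,2)`. -/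
def w : Fin 12 → (Fin 6 → ℤ) :=
  ![![0, 1, 0, 0, 0, 0],
    ![0, 0, 1, 0, 0, 0],
    ![0, 0, 0, 1, 0, 0],
    ![0, 0, 0, 0, 1, 0],
    ![0, 0, 0, 0, 0, 1],
    ![1, 0, 2, 1, 1, 2],
    ![1, 2, 0, 2, 1, 1],
    ![1, 1, 2, 0, 2, 1],
    ![1, 1, 1, 2, 0, 2],
    ![1, 2, 1, 1, 2, 0],
    ![2, 2, 1, 4, 1, 3],
    ![2, 3, 1, 4, 1, 2]]

theorem toR_sum_zsmul {d n : ℕ} (c : Fin n → ℤ) (v : Fin n → (Fin d → ℤ)) :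
    toR (∑ k, c k • v k) = ∑ k, (c k : ℝ) • toR (v k) := by
  ext i
  simp [toR]

theorem exists_sum_zsmul_of_closure_eq_top {d n : ℕ} {y : Fin n → (Fin d → ℤ)}
    (hy : AddSubgroup.closure (Set.range y) = ⊤) (x : Fin d → ℤ) :
    ∃ c : Fin n → ℤ, ∑ k, c k • y k = x := by
  rw [← Submodule.mem_span_range_iff_exists_fun ℤ, ← Submodule.mem_toAddSubgroup,
    Submodule.span_int_eq_addSubgroupClosure, hy]
  trivial

/-- A generating family of `d` vectors of `ℤ^d` is linearly independent over `ℝ`. -/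
theorem linearIndependent_toR_of_closure_eq_top {d : ℕ} {y : Fin d → (Fin d → ℤ)}
    (hy : AddSubgroup.closure (Set.range y) = ⊤) :
    LinearIndependent ℝ fun k => toR (y k) := by
  refine linearIndependent_of_top_le_span_of_card_eq_finrank ?_ (by simp)
  rw [← (Pi.basisFun ℝ (Fin d)).span_eq, Submodule.span_le]
  rintro _ ⟨i, rfl⟩
  obtain ⟨c, hc⟩ := exists_sum_zsmul_of_closure_eq_top hy (Pi.single i 1)
  refine (Submodule.mem_span_range_iff_exists_fun ℝ).2 ⟨fun k => (c k : ℝ), ?_⟩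
  rw [← toR_sum_zsmul, hc]
  ext j
  by_cases h : j = i <;> simp [toR, h]

/-- The lattice points of a unimodular simplicial cone are nonnegative integral combinations
of its generators. -/
theorem exists_sum_nsmul_of_mem_coneFin {d : ℕ} {y : Fin d → (Fin d → ℤ)}
    (hy : AddSubgroup.closure (Set.range y) = ⊤) {x : Fin d → ℤ} (hx : toR x ∈ coneFin y) :
    ∃ c : Fin d → ℕ, x = ∑ k, c k • y k := by
  obtain ⟨a, ha, hxa⟩ := hx
  obtain ⟨c, rfl⟩ := exists_sum_zsmul_of_closure_eq_top hy x
  rw [toR_sum_zsmul] at hxa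
  have hac : ∀ k, (c k : ℝ) = a k := by
    have hli := Fintype.linearIndependent_iff.1 (linearIndependent_toR_of_closure_eq_top hy)
      (fun k => c k - a k) (by simp only [sub_smul, Finset.sum_sub_distrib, hxa, sub_self])
    exact fun k => sub_eq_zero.1 (hli k)
  have hc : ∀ k, 0 ≤ c k := fun k => by
    have := ha k
    rw [← hac] at this
    exact_mod_cast this
  lift c to Fin d → ℕ using hc
  exact ⟨c, by simp⟩

/-- A combination of vectors `v (f k)` is a combination of the `v i` whose support has at most
as many elements as there are indices `k`. -/
theorem exists_sum_nsmul_card_support_le {M : Type*} [AddCommMonoid M] {m n : ℕ}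
    (v : Fin n → M) (f : Fin m → Fin n) (c : Fin m → ℕ) :
    ∃ a : Fin n → ℕ, ∑ k, c k • v (f k) = ∑ i, a i • v i ∧
      (Finset.univ.filter fun i => a i ≠ 0).card ≤ m := by
  refine ⟨fun i => ∑ k with f k = i, c k, ?_, ?_⟩
  · rw [← Finset.sum_fiberwise Finset.univ f]
    refine Finset.sum_congr rfl fun i _ => ?_
    rw [Finset.sum_smul]
    refine Finset.sum_congr rfl fun k hk => ?_
    rw [(Finset.mem_filter.1 hk).2]
  · calc _ ≤ (Finset.univ.image f).card := by
          refine Finset.card_le_card fun i hi => ?_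
          obtain ⟨k, hk, -⟩ := Finset.exists_ne_zero_of_sum_ne_zero (Finset.mem_filter.1 hi).2
          exact Finset.mem_image.2 ⟨k, Finset.mem_univ k, (Finset.mem_filter.1 hk).2⟩
      _ ≤ m := by simpa using Finset.card_image_le (s := Finset.univ) (f := f)

/-- A lattice point that is not a nonnegative integral combination of fewer than `d + 1` of the
vectors `v i` lies in no unimodular cone generated by `d` of them. -/
theorem notMem_coneFin_of_forall_lt_card_support {d n : ℕ} {v : Fin n → (Fin d → ℤ)}
    {x : Fin d → ℤ}
    (hx : ∀ a : Fin n → ℕ, x = ∑ i, a i • v i →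
      d < (Finset.univ.filter fun i => a i ≠ 0).card)
    {y : Fin d → (Fin d → ℤ)} (hyv : ∀ k, ∃ i, y k = v i)
    (hy : AddSubgroup.closure (Set.range y) = ⊤) : toR x ∉ coneFin y := by
  intro hxy
  obtain ⟨c, hc⟩ := exists_sum_nsmul_of_mem_coneFin hy hxy
  choose f hf using hyv
  obtain ⟨a, ha, hcard⟩ := exists_sum_nsmul_card_support_le v f c
  refine (hx a ?_).not_ge hcard
  rw [← ha, hc]
  simp only [hf]

/-- A lattice point of `C₁₂` that needs seven generators. -/
def badPoint : Fin 6 → ℤ := ![13, 19, 19, 17, 19, 19]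

theorem toR_badPoint_mem : toR badPoint ∈ coneFin w := by
  let c : Fin 12 → ℕ := ![1, 7, 0, 2, 8, 0, 0, 2, 0, 5, 3, 0]
  have h : badPoint = ∑ i, (c i : ℤ) • w i := by decide +kernel
  exact ⟨fun i => c i, fun i => Nat.cast_nonneg _, by rw [h, toR_sum_zsmul]; simp⟩

set_option synthInstance.maxSize 1000 in
/-- The exhaustive search behind the failure of (ICP): `p, q, r, s, t, u` are the coefficients of
the last six generators. The coefficient of the sixth generator is determined by them through the
first coordinate, those of the first five are the defects in the remaining coordinates. -/
theorem badPoint_search :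
    ∀ u < 7, ∀ t < 7 - u, ∀ s < 14 - 2 * (t + u), ∀ r < 14 - (s + 2 * (t + u)),
    ∀ q < 14 - (r + s + 2 * (t + u)), ∀ p < 14 - (q + r + s + 2 * (t + u)),
      (19 < 2 * p + q + r + 2 * s + 2 * t + 3 * u) ∨
      (19 < 2 * (13 - (p + q + r + s + 2 * (t + u))) + 2 * q + r + s + t + u) ∨
      (17 < 13 - (p + q + r + s + 2 * (t + u)) + 2 * p + 2 * r + s + 4 * t + 4 * u) ∨
      (19 < 13 - (p + q + r + s + 2 * (t + u)) + p + 2 * q + 2 * s + t + u) ∨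
      (19 < 2 * (13 - (p + q + r + s + 2 * (t + u))) + p + q + 2 * r + 3 * t + 2 * u) ∨
      7 ≤ (if 2 * p + q + r + 2 * s + 2 * t + 3 * u = 19 then 0 else 1) +
        (if 2 * (13 - (p + q + r + s + 2 * (t + u))) + 2 * q + r + s + t + u = 19
          then 0 else 1) +
        (if 13 - (p + q + r + s + 2 * (t + u)) + 2 * p + 2 * r + s + 4 * t + 4 * u = 17
          then 0 else 1) +
        (if 13 - (p + q + r + s + 2 * (t + u)) + p + 2 * q + 2 * s + t + u = 19
          then 0 else 1) +
        (if 2 * (13 - (p + q + r + s + 2 * (t + u))) + p + q + 2 * r + 3 * t + 2 * u = 19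
          then 0 else 1) +
        (if 13 - (p + q + r + s + 2 * (t + u)) = 0 then 0 else 1) +
        (if p = 0 then 0 else 1) + (if q = 0 then 0 else 1) + (if r = 0 then 0 else 1) +
        (if s = 0 then 0 else 1) + (if t = 0 then 0 else 1) + (if u = 0 then 0 else 1) := by
  decide +kernel

theorem seven_le_card_support_of_badPoint_eq (a : Fin 12 → ℕ)
    (ha : badPoint = ∑ i, a i • w i) :
    7 ≤ (Finset.univ.filter fun i => a i ≠ 0).card := by
  have e0 := congrFun ha 0
  have e1 := congrFun ha 1
  have e2 := congrFun ha 2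
  have e3 := congrFun ha 3
  have e4 := congrFun ha 4
  have e5 := congrFun ha 5
  simp [badPoint, w, Fin.sum_univ_succ] at e0 e1 e2 e3 e4 e5
  have key := badPoint_search (a 11) (by omega) (a 10) (by omega) (a 9) (by omega) (a 8) (by omega)
    (a 7) (by omega) (a 6) (by omega)
  rw [show 13 - (a 6 + a 7 + a 8 + a 9 + 2 * (a 10 + a 11)) = a 5 by omega] at key
  replace key := (((((key.resolve_left (by omega)).resolve_left (by omega)).resolve_left
    (by omega)).resolve_left (by omega)).resolve_left (by omega))
  have h0 : 2 * a 6 + a 7 + a 8 + 2 * a 9 + 2 * a 10 + 3 * a 11 = 19 ↔ a 0 = 0 := by omega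
  have h1 : 2 * a 5 + 2 * a 7 + a 8 + a 9 + a 10 + a 11 = 19 ↔ a 1 = 0 := by omega
  have h2 : a 5 + 2 * a 6 + 2 * a 8 + a 9 + 4 * a 10 + 4 * a 11 = 17 ↔ a 2 = 0 := by omega
  have h3 : a 5 + a 6 + 2 * a 7 + 2 * a 9 + a 10 + a 11 = 19 ↔ a 3 = 0 := by omega
  have h4 : 2 * a 5 + a 6 + a 7 + 2 * a 8 + 3 * a 10 + 2 * a 11 = 19 ↔ a 4 = 0 := by omega
  simp only [h0, h1, h2, h3, h4] at key
  simpa [Finset.card_filter, Fin.sum_univ_succ, add_assoc] using key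

/-- `C₁₂` fails both (UHC) and (ICP): some point of `C₁₂` lies in no cone
generated by six of the twelve generators forming a `ℤ`-basis of `ℤ⁶`, and some
lattice point of `C₁₂` needs at least seven nonzero coefficients in every
representation as a nonnegative integral combination of the generators. -/
theorem C12_fails_UHC_and_ICP :
    (∃ x ∈ coneFin w, ∀ y : Fin 6 → (Fin 6 → ℤ),
      (∀ k, ∃ i, y k = w i) →
      LinearIndependent ℤ y →
      AddSubgroup.closure (Set.range y) = ⊤ →
      x ∉ coneFin y) ∧
    (∃ x : Fin 6 → ℤ, toR x ∈ coneFin w ∧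
      ∀ a : Fin 12 → ℕ, x = ∑ i, a i • w i →
        7 ≤ (Finset.univ.filter fun i => a i ≠ 0).card) :=
  ⟨⟨toR badPoint, toR_badPoint_mem, fun _ hyw _ hy =>
      notMem_coneFin_of_forall_lt_card_support seven_le_card_support_of_badPoint_eq hyw hy⟩,
    badPoint, toR_badPoint_mem, seven_le_card_support_of_badPoint_eq⟩
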